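/- arXiv:2312.11960 — 5 statements merged into one kernel-verified Lean document; each statement's English description precedes it below -/
import Mathlib

section
/- Let G=(V,E⁺,E⁻) be a signed graph, S an offensive alliance of G, and u a vertex with u∈∂S. Then |S| ≥ deg⁺(u)+1. -/
/-- A signed graph on a vertex type `V`: a set of positive edges and a set of
negative edges, given as two simple graphs with disjoint edge sets. -/
structure SignedGraph (V : Type*) where
  pos : SimpleGraph V
  neg : SimpleGraph V
  disj : ∀ u v : V, ¬ (pos.Adj u v ∧ neg.Adj u v)

namespace SignedGraph

variable {V : Type*}

/-- The positive neighborhood `N⁺(v)`. -/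
def Np (G : SignedGraph V) (v : V) : Set V := {u | G.pos.Adj v u}

/-- The negative neighborhood `N⁻(v)`. -/
def Nn (G : SignedGraph V) (v : V) : Set V := {u | G.neg.Adj v u}

/-- The (open) neighborhood `N(v) = N⁺(v) ∪ N⁻(v)`. -/
def Nbr (G : SignedGraph V) (v : V) : Set V := G.Np v ∪ G.Nn v

/-- The positive degree `deg⁺(v)`. -/
noncomputable def degp (G : SignedGraph V) (v : V) : ℕ := (G.Np v).ncard

/-- The negative degree `deg⁻(v)`. -/
noncomputable def degn (G : SignedGraph V) (v : V) : ℕ := (G.Nn v).ncard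

/-- The positive degree with respect to a set `S`: `deg⁺_S(v) = |N⁺(v) ∩ S|`. -/
noncomputable def degpIn (G : SignedGraph V) (S : Set V) (v : V) : ℕ := (G.Np v ∩ S).ncard

/-- The negative degree with respect to a set `S`: `deg⁻_S(v) = |N⁻(v) ∩ S|`. -/
noncomputable def degnIn (G : SignedGraph V) (S : Set V) (v : V) : ℕ := (G.Nn v ∩ S).ncard

/-- The boundary `∂S = (⋃_{v ∈ S} N(v)) \ S`. -/
def boundary (G : SignedGraph V) (S : Set V) : Set V := (⋃ v ∈ S, G.Nbr v) \ S

/-- `S` is an offensive alliance: every boundary vertex `v` satisfies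
`deg⁻_S(v) ≥ deg⁺_S(v)` and `deg⁻_S(v) ≥ deg⁺_{S̄}(v) + 1`. -/
def IsOffensive (G : SignedGraph V) (S : Set V) : Prop :=
  ∀ v ∈ G.boundary S,
    G.degpIn S v ≤ G.degnIn S v ∧ G.degpIn Sᶜ v + 1 ≤ G.degnIn S v

/-- The offensive alliance number `a_so(G)`: the least size of a nonempty offensive alliance. -/
noncomputable def aso (G : SignedGraph V) : ℕ :=
  sInf {n | ∃ S : Set V, S.Nonempty ∧ G.IsOffensive S ∧ S.ncard = n}

/-- `S` is a minimum-size nonempty offensive alliance. -/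
def IsMinOffensive (G : SignedGraph V) (S : Set V) : Prop :=
  S.Nonempty ∧ G.IsOffensive S ∧
    ∀ T : Set V, T.Nonempty → G.IsOffensive T → S.ncard ≤ T.ncard

/-- The minimum positive degree `δ⁺(G)`. -/
noncomputable def minPosDeg (G : SignedGraph V) : ℕ := sInf (Set.range G.degp)

/-- The maximum negative degree `Δ⁻(G)`. -/
noncomputable def maxNegDeg (G : SignedGraph V) : ℕ := sSup (Set.range G.degn)

/-- The underlying unsigned graph `(V, E⁺ ∪ E⁻)`. -/
def underlying (G : SignedGraph V) : SimpleGraph V := G.pos ⊔ G.neg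

/-- `G` is connected if its underlying unsigned graph is connected. -/
def Connected (G : SignedGraph V) : Prop := G.underlying.Connected

/-- `G` is a complete signed graph that is (weakly) `k`-balanced with positive components
`P 0, …, P (k-1)`: the `P i` are nonempty, pairwise disjoint, cover `V`, the positive edges
are exactly the pairs of distinct vertices inside a common part, and the negative edges are
exactly the pairs of distinct vertices in no common part. -/
def IsKBalanced (G : SignedGraph V) (k : ℕ) (P : Fin k → Set V) : Prop :=
  (∀ i, (P i).Nonempty) ∧
  (∀ i j : Fin k, i ≠ j → Disjoint (P i) (P j)) ∧
  (⋃ i, P i) = Set.univ ∧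
  (∀ u v : V, G.pos.Adj u v ↔ u ≠ v ∧ ∃ i, u ∈ P i ∧ v ∈ P i) ∧
  (∀ u v : V, G.neg.Adj u v ↔ u ≠ v ∧ ¬ ∃ i, u ∈ P i ∧ v ∈ P i)

/-- `G` is a complete signed graph that is (weakly) `k`-anti-balanced with negative components
`P 0, …, P (k-1)`. -/
def IsKAntiBalanced (G : SignedGraph V) (k : ℕ) (P : Fin k → Set V) : Prop :=
  (∀ i, (P i).Nonempty) ∧
  (∀ i j : Fin k, i ≠ j → Disjoint (P i) (P j)) ∧
  (⋃ i, P i) = Set.univ ∧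
  (∀ u v : V, G.neg.Adj u v ↔ u ≠ v ∧ ∃ i, u ∈ P i ∧ v ∈ P i) ∧
  (∀ u v : V, G.pos.Adj u v ↔ u ≠ v ∧ ¬ ∃ i, u ∈ P i ∧ v ∈ P i)

/-- `V` can be partitioned into `t` classes such that vertices in a common class have the same
positive neighborhoods and the same negative neighborhoods (up to each other). -/
def GoodSndPartition (G : SignedGraph V) (t : ℕ) : Prop :=
  ∃ C : Fin t → Set V,
    (⋃ i, C i) = Set.univ ∧
    (∀ i j : Fin t, i ≠ j → Disjoint (C i) (C j)) ∧
    ∀ i : Fin t, ∀ u ∈ C i, ∀ v ∈ C i,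
      G.Np v \ {u} = G.Np u \ {v} ∧ G.Nn v \ {u} = G.Nn u \ {v}

/-- The signed neighborhood diversity `snd(G)`. -/
noncomputable def snd (G : SignedGraph V) : ℕ := sInf {t | G.GoodSndPartition t}

/-- The signed subgraph induced on a set `W` of vertices. -/
def restrict (G : SignedGraph V) (W : Set V) : SignedGraph W where
  pos := G.pos.induce W
  neg := G.neg.induce W
  disj := fun u v h => G.disj u.val v.val h

end SignedGraph

namespace SignedGraph

variable {V : Type*}

theorem degpIn_add_degpIn_compl [Finite V] (G : SignedGraph V) (S : Set V) (v : V) :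
    G.degpIn S v + G.degpIn Sᶜ v = G.degp v :=
  Set.ncard_inter_add_ncard_sdiff_eq_ncard (G.Np v) S

theorem degpIn_add_degnIn_le_ncard [Finite V] (G : SignedGraph V) (S : Set V) (v : V) :
    G.degpIn S v + G.degnIn S v ≤ S.ncard := by
  have hdisj : Disjoint (G.Np v ∩ S) (G.Nn v ∩ S) :=
    Set.disjoint_left.2 fun w hp hn => G.disj v w ⟨hp.1, hn.1⟩
  rw [degpIn, degnIn, ← Set.ncard_union_eq hdisj]
  exact Set.ncard_le_ncard (Set.union_subset Set.inter_subset_right Set.inter_subset_right)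

end SignedGraph

theorem signed_offensive_boundary_size {V : Type*} [Fintype V]
    (G : SignedGraph V) (S : Set V) (hS : G.IsOffensive S)
    (u : V) (hu : u ∈ G.boundary S) :
    G.degp u + 1 ≤ S.ncard := by
  have hle := G.degpIn_add_degnIn_le_ncard S u
  have hdeg := G.degpIn_add_degpIn_compl S u
  have hneg := (hS u hu).2
  omega
end

section
/- Let K_n=(V,E⁺,E⁻) be a complete signed graph that is (weakly) k-balanced with positive components V_1,…,V_k, |V_1| ≥ … ≥ |V_k|. Let S = S_1∪…∪S_p with p ≥ 2, where ∅ ≠ S_j ⊆ V_{i_j} for pairwise distinct indices i_1 < i_2 < … < i_p. Then S is a minimum nonempty offensive alliance of K_n if and only if |S| = |V_1| and |S| ≥ 2·|S_l|, where l is an index j∈{1,…,p} maximizing |S_j| among those j with V_{i_j}∖S_j ≠ ∅. -/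
namespace SignedGraph

variable {V : Type*}

theorem IsKBalanced.mem_iff_eq {G : SignedGraph V} {k : ℕ} {P : Fin k → Set V}
    (hbal : G.IsKBalanced k P) {v : V} {i : Fin k} (hv : v ∈ P i) (j : Fin k) :
    v ∈ P j ↔ j = i := by
  refine ⟨fun hj => ?_, fun h => h ▸ hv⟩
  by_contra hne
  exact Set.disjoint_left.mp (hbal.2.1 j i hne) hj hv

theorem IsKBalanced.Np_eq {G : SignedGraph V} {k : ℕ} {P : Fin k → Set V}
    (hbal : G.IsKBalanced k P) {v : V} {i : Fin k} (hv : v ∈ P i) :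
    G.Np v = P i \ {v} := by
  ext u
  simp only [Np, Set.mem_ofPred_eq, hbal.2.2.2.1, hbal.mem_iff_eq hv, exists_eq_left,
    Set.mem_sdiff, Set.mem_singleton_iff]
  tauto

theorem IsKBalanced.Nn_eq {G : SignedGraph V} {k : ℕ} {P : Fin k → Set V}
    (hbal : G.IsKBalanced k P) {v : V} {i : Fin k} (hv : v ∈ P i) :
    G.Nn v = (P i)ᶜ := by
  ext u
  simp only [Nn, Set.mem_ofPred_eq, hbal.2.2.2.2, hbal.mem_iff_eq hv, exists_eq_left,
    Set.mem_compl_iff]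
  exact ⟨fun h => h.2, fun h => ⟨fun hvu => h (hvu ▸ hv), h⟩⟩

theorem IsKBalanced.boundary_eq {G : SignedGraph V} {k : ℕ} {P : Fin k → Set V}
    (hbal : G.IsKBalanced k P) {S : Set V} (hS : S.Nonempty) : G.boundary S = Sᶜ := by
  ext v
  obtain ⟨s, hs⟩ := hS
  refine ⟨fun h => h.2, fun hv => ⟨?_, hv⟩⟩
  simp only [Set.mem_iUnion]
  refine ⟨s, hs, ?_⟩
  have hsv : s ≠ v := fun h => hv (h ▸ hs)
  by_cases h : ∃ i, s ∈ P i ∧ v ∈ P i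
  · exact Or.inl ((hbal.2.2.2.1 s v).2 ⟨hsv, h⟩)
  · exact Or.inr ((hbal.2.2.2.2 s v).2 ⟨hsv, h⟩)

/-- In a `k`-balanced complete signed graph, whether a nonempty set is an offensive alliance
depends only on its size and the sizes of its traces on the parts it does not contain. -/
theorem IsKBalanced.isOffensive_iff [Finite V] {G : SignedGraph V} {k : ℕ}
    {P : Fin k → Set V} (hbal : G.IsKBalanced k P) {S : Set V} (hS : S.Nonempty) :
    G.IsOffensive S ↔ ∀ i, (P i \ S).Nonempty →
      (P i).ncard ≤ S.ncard ∧ 2 * (P i ∩ S).ncard ≤ S.ncard := by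
  have key : ∀ i, ∀ v ∈ P i \ S,
      ((G.degpIn S v ≤ G.degnIn S v ∧ G.degpIn Sᶜ v + 1 ≤ G.degnIn S v) ↔
        ((P i).ncard ≤ S.ncard ∧ 2 * (P i ∩ S).ncard ≤ S.ncard)) := by
    rintro i v ⟨hv, hvS⟩
    have hp : G.degpIn S v = (P i ∩ S).ncard := by
      rw [degpIn, hbal.Np_eq hv]
      congr 1
      ext u
      simp only [Set.mem_inter_iff, Set.mem_sdiff, Set.mem_singleton_iff]
      exact ⟨fun h => ⟨h.1.1, h.2⟩, fun h => ⟨⟨h.1, fun huv => hvS (huv ▸ h.2)⟩, h.2⟩⟩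
    have hn : G.degnIn S v = (S \ P i).ncard := by
      rw [degnIn, hbal.Nn_eq hv, Set.inter_comm, Set.sdiff_eq]
    have hpc : G.degpIn Sᶜ v + 1 = (P i \ S).ncard := by
      have : (P i \ {v}) ∩ Sᶜ = (P i \ S) \ {v} := by
        ext u
        simp only [Set.mem_inter_iff, Set.mem_sdiff, Set.mem_compl_iff]
        tauto
      rw [degpIn, hbal.Np_eq hv, this]
      exact Set.ncard_sdiff_singleton_add_one ⟨hv, hvS⟩
    have h₁ := Set.ncard_inter_add_ncard_sdiff_eq_ncard S (P i)
    have h₂ := Set.ncard_inter_add_ncard_sdiff_eq_ncard (P i) S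
    rw [Set.inter_comm] at h₁
    rw [hp, hn, hpc]
    omega
  rw [IsOffensive, hbal.boundary_eq hS]
  constructor
  · rintro h i ⟨v, hv⟩
    exact (key i v hv).1 (h v hv.2)
  · intro h v hv
    obtain ⟨i, hi⟩ := Set.mem_iUnion.1 (hbal.2.2.1 ▸ Set.mem_univ v)
    exact (key i v ⟨hi, hv⟩).2 (h i ⟨v, hi, hv⟩)

/-- The minimum nonempty offensive alliances of a `k`-balanced complete signed graph are the
offensive alliances whose size is that of a largest part. -/
theorem IsKBalanced.isMinOffensive_iff [Finite V] {G : SignedGraph V} {k : ℕ}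
    {P : Fin k → Set V} (hbal : G.IsKBalanced k P) {m : Fin k}
    (hm : ∀ i, (P i).ncard ≤ (P m).ncard) {S : Set V} (hS : S.Nonempty) :
    G.IsMinOffensive S ↔ G.IsOffensive S ∧ S.ncard = (P m).ncard := by
  have hlow : ∀ T : Set V, T.Nonempty → G.IsOffensive T → (P m).ncard ≤ T.ncard := by
    intro T hT hoff
    by_cases h : P m ⊆ T
    · exact Set.ncard_le_ncard h
    · exact ((hbal.isOffensive_iff hT).1 hoff m (Set.sdiff_nonempty.2 h)).1
  have hPm : G.IsOffensive (P m) := by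
    refine (hbal.isOffensive_iff (hbal.1 m)).2 fun i hi => ⟨hm i, ?_⟩
    have him : i ≠ m := by
      rintro rfl
      simp at hi
    simp [(hbal.2.1 i m him).inter_eq]
  constructor
  · rintro ⟨-, hoff, hmin⟩
    exact ⟨hoff, le_antisymm (hmin _ (hbal.1 m) hPm) (hlow S hS hoff)⟩
  · rintro ⟨hoff, hcard⟩
    exact ⟨hS, hoff, fun T hT hT' => hcard ▸ hlow T hT hT'⟩

end SignedGraph

theorem signed_balanced_min_offensive_iff {V : Type*} [Fintype V]
    (G : SignedGraph V) (k : ℕ) (hk : 1 ≤ k) (P : Fin k → Set V)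
    (hbal : G.IsKBalanced k P)
    (hsort : ∀ i j : Fin k, i ≤ j → (P j).ncard ≤ (P i).ncard)
    (p : ℕ) (hp : 2 ≤ p) (idx : Fin p → Fin k) (hmono : StrictMono idx)
    (Sf : Fin p → Set V) (hne : ∀ j, (Sf j).Nonempty)
    (hsub : ∀ j, Sf j ⊆ P (idx j))
    (l : Fin p) (hl : (P (idx l) \ Sf l).Nonempty)
    (hlmax : ∀ j, (P (idx j) \ Sf j).Nonempty → (Sf j).ncard ≤ (Sf l).ncard) :
    G.IsMinOffensive (⋃ j, Sf j) ↔
      (⋃ j, Sf j).ncard = (P ⟨0, hk⟩).ncard ∧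
        2 * (Sf l).ncard ≤ (⋃ j, Sf j).ncard := by
  have hS : (⋃ j, Sf j).Nonempty := by
    obtain ⟨x, hx⟩ := hne l
    exact ⟨x, Set.mem_iUnion.2 ⟨l, hx⟩⟩
  have hinter : ∀ j, P (idx j) ∩ (⋃ j, Sf j) = Sf j := by
    intro j
    ext x
    simp only [Set.mem_inter_iff, Set.mem_iUnion]
    constructor
    · rintro ⟨hx, j', hj'⟩
      have := hmono.injective ((hbal.mem_iff_eq hx (idx j')).1 (hsub j' hj'))
      exact this ▸ hj'
    · exact fun hx => ⟨hsub j hx, j, hx⟩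
  have hdiff : ∀ j, P (idx j) \ (⋃ j, Sf j) = P (idx j) \ Sf j := by
    intro j
    rw [← Set.sdiff_self_inter, hinter]
  have hmax : ∀ i, (P i).ncard ≤ (P ⟨0, hk⟩).ncard :=
    fun i => hsort _ _ (Fin.mk_le_of_le_val (Nat.zero_le _))
  rw [hbal.isMinOffensive_iff hmax hS, and_comm]
  refine and_congr_right fun hcard => ?_
  rw [hbal.isOffensive_iff hS]
  constructor
  · intro h
    have := (h (idx l) (by rwa [hdiff])).2
    rwa [hinter] at this
  · intro h i hi
    refine ⟨hcard ▸ hmax i, ?_⟩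
    by_cases hij : ∃ j, idx j = i
    · obtain ⟨j, rfl⟩ := hij
      rw [hdiff] at hi
      rw [hinter]
      have := hlmax j hi
      omega
    · have : P i ∩ (⋃ j, Sf j) = ∅ := by
        refine Set.eq_empty_of_forall_notMem ?_
        rintro x ⟨hx, hxS⟩
        obtain ⟨j, hj⟩ := Set.mem_iUnion.1 hxS
        exact hij ⟨j, (hbal.mem_iff_eq hx (idx j)).1 (hsub j hj)⟩
      simp [this]
end

section
/- Let K_n=(V,E⁺,E⁻) be a complete signed graph on n vertices that is (weakly) k-anti-balanced with negative components V_1,…,V_k. If S is a nonempty offensive alliance of K_n whose boundary is nonempty and satisfies ∂S ⊆ V_j for some j, then 2|V_j| ≥ n and |S| ≥ max{n − |V_j| + 1, 2(n − |V_j|)}. -/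
namespace SignedGraph

namespace IsKAntiBalanced

variable {V : Type*} {G : SignedGraph V} {k : ℕ} {P : Fin k → Set V}

/-- The boundary of a nonempty set in a complete signed graph is its complement. -/
theorem boundary_eq_compl (h : G.IsKAntiBalanced k P) {S : Set V} (hS : S.Nonempty) :
    G.boundary S = Sᶜ := by
  obtain ⟨-, -, -, hneg, hpos⟩ := h
  obtain ⟨s, hs⟩ := hS
  refine Set.Subset.antisymm (fun v hv => hv.2) fun v hv => ⟨?_, hv⟩
  have hne : s ≠ v := fun e => hv (e ▸ hs)
  refine Set.mem_biUnion hs ?_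
  by_cases hc : ∃ i, s ∈ P i ∧ v ∈ P i
  · exact Or.inr ((hneg s v).2 ⟨hne, hc⟩)
  · exact Or.inl ((hpos s v).2 ⟨hne, hc⟩)

theorem eq_of_mem (h : G.IsKAntiBalanced k P) {i j : Fin k} {v : V}
    (hi : v ∈ P i) (hj : v ∈ P j) : i = j := by
  by_contra hij
  exact Set.disjoint_left.1 (h.2.1 i j hij) hi hj

/-- The negative neighbors of a vertex lie in its own part. -/
theorem nn_subset (h : G.IsKAntiBalanced k P) {j : Fin k} {v : V} (hv : v ∈ P j) :
    G.Nn v ⊆ P j := by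
  intro u hu
  obtain ⟨-, i, hvi, hui⟩ := (h.2.2.2.1 v u).1 hu
  exact h.eq_of_mem hvi hv ▸ hui

/-- The vertices outside the part of `v` are positive neighbors of `v`. -/
theorem compl_subset_np (h : G.IsKAntiBalanced k P) {j : Fin k} {v : V} (hv : v ∈ P j) :
    (P j)ᶜ ⊆ G.Np v := by
  intro u hu
  refine (h.2.2.2.2 v u).2 ⟨fun e => hu (e ▸ hv), ?_⟩
  rintro ⟨i, hvi, hui⟩
  exact hu (h.eq_of_mem hvi hv ▸ hui)

end IsKAntiBalanced

end SignedGraph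

theorem signed_anti_balanced_boundary_in_one_part {V : Type*} [Fintype V]
    (G : SignedGraph V) (k : ℕ) (P : Fin k → Set V)
    (hanti : G.IsKAntiBalanced k P)
    (S : Set V) (hne : S.Nonempty) (hS : G.IsOffensive S)
    (hbne : (G.boundary S).Nonempty) (j : Fin k) (hsub : G.boundary S ⊆ P j) :
    Fintype.card V ≤ 2 * (P j).ncard ∧
      max (Fintype.card V - (P j).ncard + 1) (2 * (Fintype.card V - (P j).ncard))
        ≤ S.ncard := by
  obtain ⟨v, hv⟩ := hbne
  obtain ⟨h1, h2⟩ := hS v hv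
  have hvj : v ∈ P j := hsub hv
  rw [hanti.boundary_eq_compl hne] at hsub
  have hcS : (P j)ᶜ ⊆ S := Set.compl_subset_comm.1 hsub
  have hneg : G.degnIn S v ≤ (S ∩ P j).ncard :=
    Set.ncard_le_ncard fun u hu => ⟨hu.2, hanti.nn_subset hvj hu.1⟩
  have hpos : (P j)ᶜ.ncard ≤ G.degpIn S v :=
    Set.ncard_le_ncard fun u hu => ⟨hanti.compl_subset_np hvj hu, hcS hu⟩
  have hinter : (S ∩ P j).ncard ≤ (P j).ncard := Set.ncard_le_ncard Set.inter_subset_right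
  have hdiff : S \ P j = (P j)ᶜ := Set.inter_eq_right.2 hcS
  have hsplit := Set.ncard_inter_add_ncard_sdiff_eq_ncard S (P j)
  rw [hdiff] at hsplit
  have hcard := Set.ncard_add_ncard_compl (P j)
  rw [Nat.card_eq_fintype_card] at hcard
  omega
end

section
/- Let K=(V,E⁺,E⁻) be a complete signed graph on 2n vertices (n ≥ 1) that is (weakly) 2-balanced with positive components V_1, V_2 of equal size |V_1|=|V_2|=n. Then a_so(K) = δ⁺(K)+1 (indeed a_so(K) = n and δ⁺(K) = n−1). -/
namespace SignedGraph

variable {V : Type*} {G : SignedGraph V}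

theorem IsOffensive.degp_lt_ncard [Finite V] {S : Set V} (hS : G.IsOffensive S) {v : V}
    (hv : v ∈ G.boundary S) : G.degp v + 1 ≤ S.ncard := by
  have h := (hS v hv).2
  have hsplit : (G.Np v ∩ S).ncard + (G.Np v ∩ Sᶜ).ncard = (G.Np v).ncard := by
    rw [← Set.sdiff_eq]
    exact Set.ncard_inter_add_ncard_sdiff_eq_ncard _ _ (Set.toFinite _)
  have hdisj : Disjoint (G.Np v ∩ S) (G.Nn v ∩ S) :=
    Set.disjoint_left.2 fun u hp hn => G.disj v u ⟨hp.1, hn.1⟩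
  have hle : (G.Np v ∩ S ∪ G.Nn v ∩ S).ncard ≤ S.ncard :=
    Set.ncard_le_ncard (Set.union_subset Set.inter_subset_right Set.inter_subset_right)
  rw [Set.ncard_union_eq hdisj] at hle
  simp only [degp, degpIn, degnIn] at h ⊢
  omega

namespace IsKBalanced

variable {k : ℕ} {P : Fin k → Set V}

theorem exists_mem (h : G.IsKBalanced k P) (v : V) : ∃ i, v ∈ P i :=
  Set.mem_iUnion.1 (h.2.2.1 ▸ Set.mem_univ v)

theorem eq_of_mem (h : G.IsKBalanced k P) {v : V} {i j : Fin k} (hi : v ∈ P i) (hj : v ∈ P j) :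
    i = j := by
  by_contra hij
  exact Set.disjoint_left.1 (h.2.1 i j hij) hi hj

theorem Np_eq_s17 (h : G.IsKBalanced k P) {v : V} {i : Fin k} (hv : v ∈ P i) :
    G.Np v = P i \ {v} := by
  ext u
  simp only [Np, Set.mem_ofPred_eq, h.2.2.2.1, Set.mem_sdiff, Set.mem_singleton_iff]
  constructor
  · rintro ⟨hne, j, hvj, huj⟩
    exact ⟨h.eq_of_mem hv hvj ▸ huj, hne.symm⟩
  · rintro ⟨hu, hne⟩
    exact ⟨Ne.symm hne, i, hv, hu⟩

theorem Nn_eq_s17 (h : G.IsKBalanced k P) {v : V} {i : Fin k} (hv : v ∈ P i) :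
    G.Nn v = (P i)ᶜ := by
  ext u
  simp only [Nn, Set.mem_ofPred_eq, h.2.2.2.2, Set.mem_compl_iff]
  constructor
  · rintro ⟨-, hne⟩ hu
    exact hne ⟨i, hv, hu⟩
  · refine fun hu => ⟨fun huv => hu (huv ▸ hv), ?_⟩
    rintro ⟨j, hvj, huj⟩
    exact hu (h.eq_of_mem hv hvj ▸ huj)

theorem degp_eq (h : G.IsKBalanced k P) {v : V} {i : Fin k} (hv : v ∈ P i) :
    G.degp v = (P i).ncard - 1 := by
  rw [degp, h.Np_eq_s17 hv, Set.ncard_sdiff_singleton_of_mem hv]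

theorem boundary_eq_s17 (h : G.IsKBalanced k P) {S : Set V} (hS : S.Nonempty) :
    G.boundary S = Sᶜ := by
  obtain ⟨u, hu⟩ := hS
  ext v
  refine ⟨fun hv => hv.2, fun hv => ⟨Set.mem_biUnion hu ?_, hv⟩⟩
  have hne : v ≠ u := fun e => hv (e ▸ hu)
  obtain ⟨i, hi⟩ := h.exists_mem u
  rw [Nbr, h.Np_eq_s17 hi, h.Nn_eq_s17 hi]
  by_cases hvi : v ∈ P i
  · exact Or.inl ⟨hvi, hne⟩
  · exact Or.inr hvi

end IsKBalanced

theorem IsKBalanced.isOffensive_part {P : Fin 2 → Set V} [Finite V] (h : G.IsKBalanced 2 P)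
    (hcard : (P 0).ncard = (P 1).ncard) : G.IsOffensive (P 0) := by
  intro v hv
  have hv0 : v ∉ P 0 := hv.2
  have hv1 : v ∈ P 1 := by
    obtain ⟨i, hi⟩ := h.exists_mem v
    fin_cases i
    · exact absurd hi hv0
    · exact hi
  have hd : Disjoint (P 0) (P 1) := h.2.1 0 1 (by decide)
  have hn : G.degnIn (P 0) v = (P 0).ncard := by
    rw [degnIn, h.Nn_eq_s17 hv1, Set.inter_eq_right.2 hd.subset_compl_right]
  have hle : G.degpIn (P 0)ᶜ v ≤ G.degp v := Set.ncard_le_ncard Set.inter_subset_left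
  have hpos : 0 < (P 1).ncard := (Set.ncard_pos).2 ⟨v, hv1⟩
  rw [h.degp_eq hv1] at hle
  rw [hn]
  exact ⟨Set.ncard_le_ncard Set.inter_subset_right, by omega⟩

end SignedGraph

theorem signed_two_balanced_equal_parts_aso {V : Type*} [Fintype V]
    (G : SignedGraph V) (n : ℕ) (hn : 1 ≤ n) (P : Fin 2 → Set V)
    (hbal : G.IsKBalanced 2 P)
    (h0 : (P 0).ncard = n) (h1 : (P 1).ncard = n)
    (hcard : Fintype.card V = 2 * n) :
    G.aso = G.minPosDeg + 1 ∧ G.aso = n ∧ G.minPosDeg = n - 1 := by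
  have hpart : ∀ i, (P i).ncard = n := by
    intro i
    fin_cases i
    · exact h0
    · exact h1
  have hdeg : ∀ v, G.degp v = n - 1 := fun v => by
    obtain ⟨i, hi⟩ := hbal.exists_mem v
    rw [hbal.degp_eq hi, hpart]
  have hmin : G.minPosDeg = n - 1 := by
    obtain ⟨v, -⟩ := hbal.1 0
    have : Nonempty V := ⟨v⟩
    rw [SignedGraph.minPosDeg, funext hdeg, Set.range_const, csInf_singleton]
  have haso : G.aso = n := by
    have hmem : n ∈ {m | ∃ S : Set V, S.Nonempty ∧ G.IsOffensive S ∧ S.ncard = m} :=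
      ⟨P 0, hbal.1 0, hbal.isOffensive_part (h0.trans h1.symm), h0⟩
    refine le_antisymm (Nat.sInf_le hmem) (le_csInf ⟨n, hmem⟩ ?_)
    rintro m ⟨S, hne, hS, rfl⟩
    by_cases huniv : S = Set.univ
    · rw [huniv, Set.ncard_univ, Nat.card_eq_fintype_card, hcard]
      omega
    · obtain ⟨v, hv⟩ := (Set.ne_univ_iff_exists_notMem S).1 huniv
      have := hS.degp_lt_ncard (v := v) (hbal.boundary_eq_s17 hne ▸ hv)
      rw [hdeg] at this
      omega
  exact ⟨by omega, haso, hmin⟩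
end

section
/- Let G=(V,E⁺,E⁻) be a signed graph and let D ⊆ V be such that the induced signed subgraph G−D is a complete signed graph that is (weakly) k-anti-balanced. Then snd(G) ≤ k·3^{|D|} + |D|. -/
namespace SignedGraph

variable {V : Type*}

/-- A coloring whose color classes consist of pairwise twins bounds `snd`. -/
lemma snd_le_card_of_coloring {α : Type*} [Fintype α] (G : SignedGraph V) (f : V → α)
    (hf : ∀ u v w, f u = f v → w ≠ u → w ≠ v →
      (G.pos.Adj v w ↔ G.pos.Adj u w) ∧ (G.neg.Adj v w ↔ G.neg.Adj u w)) :
    G.snd ≤ Fintype.card α := by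
  refine Nat.sInf_le ⟨fun i => {v | Fintype.equivFin α (f v) = i}, ?_, ?_, ?_⟩
  · ext v
    simp
  · intro i j hij
    rw [Set.disjoint_left]
    rintro v rfl hv
    exact hij hv
  · intro i u hu v hv
    have huv : f u = f v := (Fintype.equivFin α).injective (hu.trans hv.symm)
    constructor <;> ext w <;> by_cases hwu : w = u <;> by_cases hwv : w = v
    all_goals simp only [Np, Nn, Set.mem_sdiff, Set.mem_ofPred_eq, Set.mem_singleton_iff]
    any_goals simp_all; done
    · simpa [hwu, hwv] using (hf u v w huv hwu hwv).1
    · simpa [hwu, hwv] using (hf u v w huv hwu hwv).2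

open Classical in
/-- The relation between two vertices: positive edge, negative edge, or neither. -/
noncomputable def adjType (G : SignedGraph V) (u v : V) : Fin 3 :=
  if G.pos.Adj u v then 0 else if G.neg.Adj u v then 1 else 2

lemma adjType_eq_zero (G : SignedGraph V) (u v : V) : G.adjType u v = 0 ↔ G.pos.Adj u v := by
  unfold adjType
  split_ifs <;> simp_all

lemma adjType_eq_one (G : SignedGraph V) (u v : V) : G.adjType u v = 1 ↔ G.neg.Adj u v := by
  have := G.disj u v
  unfold adjType
  split_ifs <;> simp_all

end SignedGraph

theorem signed_snd_le_distance_to_anti_balanced {V : Type*} [Fintype V]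
    (G : SignedGraph V) (D : Set V) (k : ℕ) (P : Fin k → Set ↥(Dᶜ))
    (hanti : (G.restrict Dᶜ).IsKAntiBalanced k P) :
    G.snd ≤ k * 3 ^ D.ncard + D.ncard := by
  classical
  obtain ⟨-, hdisj, hcover, hneg, hpos⟩ := hanti
  have hpart : ∀ v : ↥(Dᶜ), ∃ i, v ∈ P i := fun v => by
    simpa using hcover.symm.subset (Set.mem_univ v)
  choose part hpart using hpart
  have huniq : ∀ v i, v ∈ P i ↔ part v = i := fun v i =>
    ⟨fun h => by_contra fun hne => Set.disjoint_left.1 (hdisj _ _ hne) (hpart v) h,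
      fun h => h ▸ hpart v⟩
  simp only [huniq, exists_eq_left'] at hneg hpos
  let f : V → (Fin k × (D → Fin 3)) ⊕ D := fun v =>
    if h : v ∈ D then .inr ⟨v, h⟩ else .inl (part ⟨v, h⟩, fun d => G.adjType v d)
  have hcard : Fintype.card ((Fin k × (D → Fin 3)) ⊕ D) = k * 3 ^ D.ncard + D.ncard := by
    simp [← Nat.card_coe_set_eq, Nat.card_eq_fintype_card]
  rw [← hcard]
  refine G.snd_le_card_of_coloring f fun u v w huv hwu hwv => ?_
  by_cases hu : u ∈ D <;> by_cases hv : v ∈ D <;>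
    simp only [f, hu, hv, dite_true, dite_false, Sum.inr.injEq, Sum.inl.injEq, reduceCtorEq,
      Subtype.mk.injEq, Prod.mk.injEq] at huv
  · simp [huv]
  obtain ⟨hp, ht⟩ := huv
  by_cases hw : w ∈ D
  · have htw : G.adjType u w = G.adjType v w := congrFun ht ⟨w, hw⟩
    simp only [← SignedGraph.adjType_eq_zero, ← SignedGraph.adjType_eq_one, htw, and_self]
  · have hnu : G.neg.Adj u w ↔ _ := hneg ⟨u, hu⟩ ⟨w, hw⟩
    have hnv : G.neg.Adj v w ↔ _ := hneg ⟨v, hv⟩ ⟨w, hw⟩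
    have hpu : G.pos.Adj u w ↔ _ := hpos ⟨u, hu⟩ ⟨w, hw⟩
    have hpv : G.pos.Adj v w ↔ _ := hpos ⟨v, hv⟩ ⟨w, hw⟩
    rw [hnu, hnv, hpu, hpv, hp]
    simp [hwu.symm, hwv.symm]
end
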